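/- Let n ≥ 1, let γ ∈ ℝ with γ ≠ 1 and γ ≠ 2, let μ : ℝⁿ → ℝ be smooth with μ > 0, let δ > 0, and let ρ, Φ : (−δ, δ) × ℝⁿ → ℝ be smooth with ρ(t,x) > 0 for all (t,x). Assume there is a compact set K ⊆ ℝⁿ such that Φ(t,x) = 0 and ρ(t,x) = ρ(0,x) for all t ∈ (−δ,δ) and x ∉ K, and that the pair (ρ, Φ) satisfies ∂_t ρ + ∇·(ρ^γ ∇Φ) = 0 and ∂_t Φ + (γ/2)·ρ^{γ−1}·‖∇Φ‖² = 0 on (−δ,δ) × ℝⁿ. Let f(s) = (s^{2−γ} − 1)/((1−γ)(2−γ)) and define G(t) = ∫_{ℝⁿ} [ f(ρ(t,x)/μ(x)) − f(ρ(0,x)/μ(x)) ]·μ(x) dx. Then G is twice differentiable at t = 0 and, writing ρ₀ = ρ(0,·), Φ₀ = Φ(0,·), G''(0) = ∫_{ℝⁿ} ρ₀^γ { −Δ(μ^{γ−1})·‖∇Φ₀‖² − (1/(γ−1))·Hess(μ^{γ−1})(∇Φ₀, ∇Φ₀) + μ^{γ−1}·‖Hess Φ₀‖² + γ(γ−1)·μ^{γ−1}·(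 ⟨∇ρ₀/ρ₀, ∇Φ₀⟩·⟨∇μ/μ, ∇Φ₀⟩ − (1/2)·⟨∇ρ₀/ρ₀, ∇μ/μ + ∇ρ₀/ρ₀⟩·‖∇Φ₀‖² ) } dx. -/

import Mathlib

open MeasureTheory Filter Set
open scoped InnerProductSpace Topology

/-- Partial derivative `∂ⱼ f x` on Euclidean space. -/
noncomputable def pder (n : ℕ) (j : Fin n) (f : EuclideanSpace ℝ (Fin n) → ℝ)
    (x : EuclideanSpace ℝ (Fin n)) : ℝ :=
  fderiv ℝ f x (EuclideanSpace.single j 1)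

/-- Divergence `∇·v` of a vector field on Euclidean space. -/
noncomputable def divg (n : ℕ) (v : EuclideanSpace ℝ (Fin n) → EuclideanSpace ℝ (Fin n))
    (x : EuclideanSpace ℝ (Fin n)) : ℝ :=
  ∑ j, pder n j (fun y => v y j) x

/-- Laplacian `Δf = ∑ⱼ ∂ⱼ∂ⱼ f`. -/
noncomputable def lapl (n : ℕ) (f : EuclideanSpace ℝ (Fin n) → ℝ)
    (x : EuclideanSpace ℝ (Fin n)) : ℝ :=
  ∑ j, pder n j (fun y => pder n j f y) x

/-- Entry `(i,j)` of the Hessian matrix of `f`. -/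
noncomputable def hessij (n : ℕ) (f : EuclideanSpace ℝ (Fin n) → ℝ)
    (x : EuclideanSpace ℝ (Fin n)) (i j : Fin n) : ℝ :=
  pder n i (fun y => pder n j f y) x

/-- Hessian quadratic form `Hess f (u,u) = ∑ᵢⱼ (∂ᵢ∂ⱼf) uᵢ uⱼ`. -/
noncomputable def hessQF (n : ℕ) (f : EuclideanSpace ℝ (Fin n) → ℝ)
    (x u : EuclideanSpace ℝ (Fin n)) : ℝ :=
  ∑ i, ∑ j, hessij n f x i j * u i * u j

/-- Squared Frobenius norm of the Hessian: `‖Hess f‖² = ∑ᵢⱼ (∂ᵢ∂ⱼf)²`. -/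
noncomputable def hessFrob (n : ℕ) (f : EuclideanSpace ℝ (Fin n) → ℝ)
    (x : EuclideanSpace ℝ (Fin n)) : ℝ :=
  ∑ i, ∑ j, (hessij n f x i j)^2

variable {n : ℕ}

lemma pder_add {f g : EuclideanSpace ℝ (Fin n) → ℝ} {x : EuclideanSpace ℝ (Fin n)} (i : Fin n)
    (hf : DifferentiableAt ℝ f x) (hg : DifferentiableAt ℝ g x) :
    pder n i (fun y => f y + g y) x = pder n i f x + pder n i g x := by
  simp [pder, fderiv_fun_add hf hg]

lemma pder_mul {f g : EuclideanSpace ℝ (Fin n) → ℝ} {x : EuclideanSpace ℝ (Fin n)} (i : Fin n)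
    (hf : DifferentiableAt ℝ f x) (hg : DifferentiableAt ℝ g x) :
    pder n i (fun y => f y * g y) x = pder n i f x * g x + f x * pder n i g x := by
  simp [pder, fderiv_fun_mul hf hg]
  ring

lemma pder_const_mul {f : EuclideanSpace ℝ (Fin n) → ℝ} {x : EuclideanSpace ℝ (Fin n)} (i : Fin n)
    (c : ℝ) (hf : DifferentiableAt ℝ f x) :
    pder n i (fun y => c * f y) x = c * pder n i f x := by
  simp [pder, fderiv_const_mul hf]

lemma pder_sum {ι : Type*} (s : Finset ι) {f : ι → EuclideanSpace ℝ (Fin n) → ℝ}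
    {x : EuclideanSpace ℝ (Fin n)} (i : Fin n) (hf : ∀ k ∈ s, DifferentiableAt ℝ (f k) x) :
    pder n i (fun y => ∑ k ∈ s, f k y) x = ∑ k ∈ s, pder n i (f k) x := by
  simp [pder, fderiv_fun_sum hf]

lemma pder_rpow {f : EuclideanSpace ℝ (Fin n) → ℝ} {x : EuclideanSpace ℝ (Fin n)} (i : Fin n)
    (a : ℝ) (hf : DifferentiableAt ℝ f x) (h : f x ≠ 0) :
    pder n i (fun y => f y ^ a) x = a * f x ^ (a - 1) * pder n i f x := by
  simp [pder, (hf.hasFDerivAt.rpow_const (p := a) (Or.inl h)).fderiv]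

lemma pder_eq_zero_of_notMem {f : EuclideanSpace ℝ (Fin n) → ℝ}
    {K : Set (EuclideanSpace ℝ (Fin n))} (hK : IsClosed K) (h : ∀ x ∉ K, f x = 0) (i : Fin n) :
    ∀ x ∉ K, pder n i f x = 0 := by
  intro x hx
  have : f =ᶠ[𝓝 x] fun _ => 0 := by
    filter_upwards [hK.isOpen_compl.mem_nhds hx] with y hy using h y hy
  simp [pder, this.fderiv_eq]

lemma ContDiff.pder {f : EuclideanSpace ℝ (Fin n) → ℝ} (hf : ContDiff ℝ (⊤ : ℕ∞) f) (i : Fin n) :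
    ContDiff ℝ (⊤ : ℕ∞) (fun x => pder n i f x) :=
  (hf.fderiv_right (m := (⊤ : ℕ∞)) (by simp)).clm_apply contDiff_const

lemma pder_comm {f : EuclideanSpace ℝ (Fin n) → ℝ} (hf : ContDiff ℝ (⊤ : ℕ∞) f) (i j : Fin n)
    (x : EuclideanSpace ℝ (Fin n)) :
    pder n i (fun y => pder n j f y) x = pder n j (fun y => pder n i f y) x := by
  have hd : DifferentiableAt ℝ (fderiv ℝ f) x :=
    (hf.fderiv_right (m := (⊤ : ℕ∞)) (by simp)).differentiable (by simp) x
  have key := (hf.contDiffAt (x := x)).isSymmSndFDerivAt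
    (by rw [minSmoothness_of_isRCLikeNormedField]; exact WithTop.coe_le_coe.2 le_top)
  have h (v w : EuclideanSpace ℝ (Fin n)) :
      fderiv ℝ (fun y => fderiv ℝ f y v) x w = fderiv ℝ (fderiv ℝ f) x w v := by
    rw [fderiv_clm_apply hd (by fun_prop)]
    simp
  unfold pder
  rw [h, h]
  exact key _ _

lemma gradient_apply (f : EuclideanSpace ℝ (Fin n) → ℝ) (x : EuclideanSpace ℝ (Fin n))
    (i : Fin n) : gradient f x i = pder n i f x := by
  rw [pder, ← inner_gradient_left, EuclideanSpace.inner_single_right]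
  simp

lemma Continuous.integrable_of_zero_off {f : EuclideanSpace ℝ (Fin n) → ℝ} (hf : Continuous f)
    {K : Set (EuclideanSpace ℝ (Fin n))} (hK : IsCompact K) (h : ∀ x ∉ K, f x = 0) :
    Integrable f :=
  hf.integrable_of_hasCompactSupport (HasCompactSupport.intro hK h)

/-- `f` is integrable with vanishing integral. -/
def HasZeroIntegral (f : EuclideanSpace ℝ (Fin n) → ℝ) : Prop :=
  Integrable f ∧ ∫ x, f x = 0

namespace HasZeroIntegral

variable {f g : EuclideanSpace ℝ (Fin n) → ℝ}

lemma add (hf : HasZeroIntegral f) (hg : HasZeroIntegral g) :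
    HasZeroIntegral fun x => f x + g x :=
  ⟨hf.1.add hg.1, by rw [integral_add hf.1 hg.1, hf.2, hg.2, add_zero]⟩

lemma sub (hf : HasZeroIntegral f) (hg : HasZeroIntegral g) :
    HasZeroIntegral fun x => f x - g x :=
  ⟨hf.1.sub hg.1, by rw [integral_sub hf.1 hg.1, hf.2, hg.2, sub_zero]⟩

lemma const_mul (hf : HasZeroIntegral f) (c : ℝ) : HasZeroIntegral fun x => c * f x :=
  ⟨hf.1.const_mul c, by rw [integral_const_mul, hf.2, mul_zero]⟩

end HasZeroIntegral

lemma integral_eq_of_eq_add {f g e : EuclideanSpace ℝ (Fin n) → ℝ} (hg : Integrable g)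
    (he : HasZeroIntegral e) (h : ∀ x, f x = g x + e x) : ∫ x, f x = ∫ x, g x := by
  rw [funext h, integral_add hg he.1, he.2, add_zero]

/-- Divergence theorem for a compactly supported field `u v`. -/
lemma integral_mul_div_add {K : Set (EuclideanSpace ℝ (Fin n))} (hK : IsCompact K)
    {u : EuclideanSpace ℝ (Fin n) → ℝ} {v : Fin n → EuclideanSpace ℝ (Fin n) → ℝ}
    (hu : ContDiff ℝ (⊤ : ℕ∞) u) (hv : ∀ i, ContDiff ℝ (⊤ : ℕ∞) (v i))
    (hz : ∀ i, ∀ x ∉ K, v i x = 0) :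
    HasZeroIntegral fun x => ∑ i, pder n i u x * v i x + u x * ∑ i, pder n i (v i) x := by
  have hz' (i : Fin n) := pder_eq_zero_of_notMem hK.isClosed (hz i) i
  have h1 (i : Fin n) : Integrable (fun x => pder n i u x * v i x) :=
    ((hu.pder i).continuous.mul (hv i).continuous).integrable_of_zero_off hK
      fun x hx => by simp [hz i x hx]
  have h2 (i : Fin n) : Integrable (fun x => u x * pder n i (v i) x) :=
    (hu.continuous.mul ((hv i).pder i).continuous).integrable_of_zero_off hK
      fun x hx => by simp [hz' i x hx]
  have h3 (i : Fin n) : Integrable (fun x => u x * v i x) :=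
    (hu.continuous.mul (hv i).continuous).integrable_of_zero_off hK
      fun x hx => by simp [hz i x hx]
  have key (i : Fin n) : ∫ x, (pder n i u x * v i x + u x * pder n i (v i) x) = 0 := by
    rw [integral_add (h1 i) (h2 i)]
    have := integral_mul_fderiv_eq_neg_fderiv_mul_of_integrable (h1 i) (h2 i) (h3 i)
      (fun x _ => hu.differentiable (by simp) x) (fun x _ => (hv i).differentiable (by simp) x)
    unfold pder at this ⊢
    linarith
  simp only [Finset.mul_sum, ← Finset.sum_add_distrib]
  have h12 (i : Fin n) : Integrable (fun x => pder n i u x * v i x + u x * pder n i (v i) x) :=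
    (h1 i).add (h2 i)
  refine ⟨integrable_finsetSum _ fun i _ => h12 i, ?_⟩
  rw [integral_finsetSum _ fun i _ => h12 i]
  exact Finset.sum_eq_zero fun i _ => key i

/-- Joint smoothness of a time-dependent function on `(-δ, δ) × ℝⁿ`. -/
abbrev JointlySmooth (δ : ℝ) (F : ℝ → EuclideanSpace ℝ (Fin n) → ℝ) : Prop :=
  ContDiffOn ℝ (⊤ : ℕ∞) (fun p : ℝ × EuclideanSpace ℝ (Fin n) => F p.1 p.2) (Ioo (-δ) δ ×ˢ univ)

variable {δ : ℝ} {F : ℝ → EuclideanSpace ℝ (Fin n) → ℝ}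

lemma isOpen_slab (n : ℕ) (δ : ℝ) :
    IsOpen (Ioo (-δ) δ ×ˢ (univ : Set (EuclideanSpace ℝ (Fin n)))) :=
  isOpen_Ioo.prod isOpen_univ

namespace JointlySmooth

lemma contDiffAt (hF : JointlySmooth δ F) {t : ℝ} (ht : t ∈ Ioo (-δ) δ)
    (x : EuclideanSpace ℝ (Fin n)) :
    ContDiffAt ℝ (⊤ : ℕ∞) (fun p : ℝ × EuclideanSpace ℝ (Fin n) => F p.1 p.2) (t, x) :=
  ContDiffOn.contDiffAt hF ((isOpen_slab n δ).mem_nhds ⟨ht, mem_univ x⟩)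

lemma slice (hF : JointlySmooth δ F) {t : ℝ} (ht : t ∈ Ioo (-δ) δ) :
    ContDiff ℝ (⊤ : ℕ∞) (F t) :=
  contDiff_iff_contDiffAt.2 fun x =>
    ContDiffAt.comp (g := fun p : ℝ × EuclideanSpace ℝ (Fin n) => F p.1 p.2) x (hF.contDiffAt ht x) (contDiffAt_const.prodMk contDiffAt_id)

lemma hasFDerivAt (hF : JointlySmooth δ F) {t : ℝ} (ht : t ∈ Ioo (-δ) δ)
    (x : EuclideanSpace ℝ (Fin n)) :
    HasFDerivAt (fun p : ℝ × EuclideanSpace ℝ (Fin n) => F p.1 p.2)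
      (fderiv ℝ (fun p : ℝ × EuclideanSpace ℝ (Fin n) => F p.1 p.2) (t, x)) (t, x) :=
  ((hF.contDiffAt ht x).differentiableAt (by simp)).hasFDerivAt

lemma hasDerivAt_fderiv (hF : JointlySmooth δ F) {t : ℝ} (ht : t ∈ Ioo (-δ) δ)
    (x : EuclideanSpace ℝ (Fin n)) :
    HasDerivAt (fun s => F s x)
      (fderiv ℝ (fun p : ℝ × EuclideanSpace ℝ (Fin n) => F p.1 p.2) (t, x) (1, 0)) t :=
  HasFDerivAt.comp_hasDerivAt (l := fun p : ℝ × EuclideanSpace ℝ (Fin n) => F p.1 p.2)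
    (f := fun s => (s, x)) t (hF.hasFDerivAt ht x) ((hasDerivAt_id t).prodMk (hasDerivAt_const t x))

lemma hasDerivAt (hF : JointlySmooth δ F) {t : ℝ} (ht : t ∈ Ioo (-δ) δ)
    (x : EuclideanSpace ℝ (Fin n)) :
    HasDerivAt (fun s => F s x) (deriv (fun s => F s x) t) t :=
  (hF.hasDerivAt_fderiv ht x).differentiableAt.hasDerivAt

lemma deriv_eq (hF : JointlySmooth δ F) {t : ℝ} (ht : t ∈ Ioo (-δ) δ)
    (x : EuclideanSpace ℝ (Fin n)) :
    deriv (fun s => F s x) t =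
      fderiv ℝ (fun p : ℝ × EuclideanSpace ℝ (Fin n) => F p.1 p.2) (t, x) (1, 0) :=
  (hF.hasDerivAt_fderiv ht x).deriv

lemma pder_eq (hF : JointlySmooth δ F) {t : ℝ} (ht : t ∈ Ioo (-δ) δ)
    (x : EuclideanSpace ℝ (Fin n)) (i : Fin n) :
    _root_.pder n i (F t) x = fderiv ℝ (fun p : ℝ × EuclideanSpace ℝ (Fin n) => F p.1 p.2) (t, x)
        (0, EuclideanSpace.single i 1) := by
  have h : HasFDerivAt (F t) _ x := (hF.hasFDerivAt ht x).comp x (hasFDerivAt_prodMk_right t x)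
  simp [_root_.pder, h.fderiv]

lemma fderiv_apply (hF : JointlySmooth δ F) (w : ℝ × EuclideanSpace ℝ (Fin n)) :
    ContDiffOn ℝ (⊤ : ℕ∞) (fun q => fderiv ℝ
      (fun p : ℝ × EuclideanSpace ℝ (Fin n) => F p.1 p.2) q w) (Ioo (-δ) δ ×ˢ univ) :=
  (ContDiffOn.fderiv_of_isOpen hF (isOpen_slab n δ) (m := (⊤ : ℕ∞)) (by simp)).clm_apply
    contDiffOn_const

lemma pder (hF : JointlySmooth δ F) (i : Fin n) :
    JointlySmooth δ (fun t x => _root_.pder n i (F t) x) :=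
  (hF.fderiv_apply (0, EuclideanSpace.single i 1)).congr fun q hq => hF.pder_eq hq.1 q.2 i

lemma deriv (hF : JointlySmooth δ F) :
    JointlySmooth δ (fun t x => _root_.deriv (fun s => F s x) t) :=
  (hF.fderiv_apply (1, 0)).congr fun q hq => hF.deriv_eq hq.1 q.2

lemma deriv_pder (hF : JointlySmooth δ F) {t : ℝ} (ht : t ∈ Ioo (-δ) δ)
    (x : EuclideanSpace ℝ (Fin n)) (i : Fin n) :
    _root_.deriv (fun s => _root_.pder n i (F s) x) t
      = _root_.pder n i (fun y => _root_.deriv (fun s => F s y) t) x := by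
  set U := fun p : ℝ × EuclideanSpace ℝ (Fin n) => F p.1 p.2
  have hd : DifferentiableAt ℝ (fderiv ℝ U) (t, x) :=
    ((ContDiffOn.fderiv_of_isOpen hF (isOpen_slab n δ) (m := (⊤ : ℕ∞)) (by simp)).contDiffAt
      ((isOpen_slab n δ).mem_nhds ⟨ht, mem_univ x⟩)).differentiableAt (by simp)
  have key := (hF.contDiffAt ht x).isSymmSndFDerivAt
    (by rw [minSmoothness_of_isRCLikeNormedField]; exact WithTop.coe_le_coe.2 le_top)
  have h (v w : ℝ × EuclideanSpace ℝ (Fin n)) :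
      fderiv ℝ (fun y => fderiv ℝ U y v) (t, x) w = fderiv ℝ (fderiv ℝ U) (t, x) w v := by
    rw [fderiv_clm_apply hd (by fun_prop)]
    simp
  have nhds : ∀ᶠ p in 𝓝 (t, x), p ∈ Ioo (-δ) δ ×ˢ (univ : Set (EuclideanSpace ℝ (Fin n))) :=
    (isOpen_slab n δ).mem_nhds ⟨ht, mem_univ x⟩
  rw [(hF.pder i).deriv_eq ht x, hF.deriv.pder_eq ht x i]
  have e1 : (fun p : ℝ × EuclideanSpace ℝ (Fin n) => _root_.pder n i (F p.1) p.2) =ᶠ[𝓝 (t, x)]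
      fun q => fderiv ℝ U q (0, EuclideanSpace.single i 1) := by
    filter_upwards [nhds] with q hq using hF.pder_eq hq.1 q.2 i
  have e2 : (fun p : ℝ × EuclideanSpace ℝ (Fin n) => _root_.deriv (fun s => F s p.2) p.1)
      =ᶠ[𝓝 (t, x)] fun q => fderiv ℝ U q (1, 0) := by
    filter_upwards [nhds] with q hq using hF.deriv_eq hq.1 q.2
  rw [e1.fderiv_eq, e2.fderiv_eq, h, h]
  exact key _ _

/-- Differentiation under the integral sign for compactly supported smooth integrands. -/
lemma hasDerivAt_integral (hF : JointlySmooth δ F) {K : Set (EuclideanSpace ℝ (Fin n))}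
    (hK : IsCompact K) (hz : ∀ t ∈ Ioo (-δ) δ, ∀ x ∉ K, F t x = 0) {t : ℝ}
    (ht : t ∈ Ioo (-δ) δ) :
    HasDerivAt (fun s => ∫ x, F s x) (∫ x, _root_.deriv (fun s => F s x) t) t := by
  obtain ⟨ε, hε, hsub⟩ := Metric.nhds_basis_closedBall.mem_iff.1 (isOpen_Ioo.mem_nhds ht)
  have hz' : ∀ s ∈ Ioo (-δ) δ, ∀ x ∉ K, _root_.deriv (fun s => F s x) s = 0 := by
    intro s hs x hx
    have : (fun s => F s x) =ᶠ[𝓝 s] fun _ => 0 := by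
      filter_upwards [isOpen_Ioo.mem_nhds hs] with r hr using hz r hr x hx
    simp [this.deriv_eq]
  have hcont : ContinuousOn (fun p : ℝ × EuclideanSpace ℝ (Fin n) =>
      _root_.deriv (fun s => F s p.2) p.1) (Metric.closedBall t ε ×ˢ K) :=
    hF.deriv.continuousOn.mono (prod_mono hsub (subset_univ K))
  obtain ⟨C, hC⟩ := ((isCompact_closedBall t ε).prod hK).exists_bound_of_continuousOn hcont
  refine (hasDerivAt_integral_of_dominated_loc_of_deriv_le (Metric.closedBall_mem_nhds t hε)
    (F := F) (F' := fun s x => _root_.deriv (fun s => F s x) s) (bound := K.indicator fun _ => C)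
    ?_ ?_ ?_ ?_ ?_ ?_).2
  · filter_upwards [isOpen_Ioo.mem_nhds ht] with s hs
    exact (hF.slice hs).continuous.aestronglyMeasurable
  · exact (hF.slice ht).continuous.integrable_of_zero_off hK (hz t ht)
  · exact (hF.deriv.slice ht).continuous.aestronglyMeasurable
  · refine Eventually.of_forall fun x s hs => ?_
    by_cases hx : x ∈ K
    · simpa [hx] using hC (s, x) ⟨hs, hx⟩
    · simp [hx, hz' s (hsub hs) x hx]
  · exact (integrable_indicator_iff hK.measurableSet).2
      (integrableOn_const hK.measure_lt_top.ne)
  · exact Eventually.of_forall fun x s hs => hF.hasDerivAt (hsub hs) x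

end JointlySmooth

attribute [fun_prop] ContDiff.pder

lemma ContDiff.lapl {f : EuclideanSpace ℝ (Fin n) → ℝ} (hf : ContDiff ℝ (⊤ : ℕ∞) f) :
    ContDiff ℝ (⊤ : ℕ∞) (fun x => lapl n f x) := by
  unfold _root_.lapl
  fun_prop

lemma ContDiff.diffAt {f : EuclideanSpace ℝ (Fin n) → ℝ} (hf : ContDiff ℝ (⊤ : ℕ∞) f)
    (x : EuclideanSpace ℝ (Fin n)) : DifferentiableAt ℝ f x :=
  hf.differentiable (by simp) x

/-- The squared length of the gradient, in coordinates. -/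
noncomputable def gradSq (Φ : EuclideanSpace ℝ (Fin n) → ℝ) (x : EuclideanSpace ℝ (Fin n)) : ℝ :=
  ∑ j, pder n j Φ x ^ 2

/-- The operator `-m Δ + c ⟨∇m, ∇·⟩`. -/
noncomputable def driftOp (c : ℝ) (m Φ : EuclideanSpace ℝ (Fin n) → ℝ)
    (x : EuclideanSpace ℝ (Fin n)) : ℝ :=
  -m x * lapl n Φ x + c * ∑ i, pder n i m x * pder n i Φ x

lemma gradient_norm_sq (Φ : EuclideanSpace ℝ (Fin n) → ℝ) (x : EuclideanSpace ℝ (Fin n)) :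
    ‖gradient Φ x‖ ^ 2 = gradSq Φ x := by
  simp [EuclideanSpace.real_norm_sq_eq, gradient_apply, gradSq]

section Expansions

variable {Φ m : EuclideanSpace ℝ (Fin n) → ℝ}

lemma contDiff_gradSq (hΦ : ContDiff ℝ (⊤ : ℕ∞) Φ) : ContDiff ℝ (⊤ : ℕ∞) (gradSq Φ) := by
  unfold gradSq
  fun_prop

lemma contDiff_driftOp (hΦ : ContDiff ℝ (⊤ : ℕ∞) Φ) (hm : ContDiff ℝ (⊤ : ℕ∞) m)
    (c : ℝ) : ContDiff ℝ (⊤ : ℕ∞) (driftOp c m Φ) := by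
  have := hΦ.lapl
  unfold driftOp
  fun_prop

lemma pder_gradSq (hΦ : ContDiff ℝ (⊤ : ℕ∞) Φ) (x : EuclideanSpace ℝ (Fin n)) (i : Fin n) :
    pder n i (gradSq Φ) x = 2 * ∑ j, hessij n Φ x i j * pder n j Φ x := by
  unfold gradSq
  simp only [pow_two]
  rw [pder_sum _ _ fun j _ => (((hΦ.pder j).mul (hΦ.pder j)).diffAt x), Finset.mul_sum]
  refine Finset.sum_congr rfl fun j _ => ?_
  rw [pder_mul _ ((hΦ.pder j).diffAt x) ((hΦ.pder j).diffAt x), hessij]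
  ring

/-- Bochner's formula. -/
lemma lapl_gradSq (hΦ : ContDiff ℝ (⊤ : ℕ∞) Φ) (x : EuclideanSpace ℝ (Fin n)) :
    lapl n (gradSq Φ) x
      = 2 * (hessFrob n Φ x + ∑ j, pder n j (lapl n Φ) x * pder n j Φ x) := by
  have h3 (i j : Fin n) : pder n i (fun y => pder n i (fun z => pder n j Φ z) y) x
      = pder n j (fun y => pder n i (fun z => pder n i Φ z) y) x := by
    rw [← pder_comm (hΦ.pder i) i j]
    congr 1
    funext y
    exact pder_comm hΦ i j y
  have h1 (i : Fin n) : pder n i (fun y => pder n i (gradSq Φ) y) x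
      = 2 * ∑ j, (hessij n Φ x i j ^ 2
          + pder n j (fun y => pder n i (fun z => pder n i Φ z) y) x * pder n j Φ x) := by
    have : (fun y => pder n i (gradSq Φ) y)
        = fun y => 2 * ∑ j, hessij n Φ y i j * pder n j Φ y :=
      funext fun y => pder_gradSq hΦ y i
    have hs (j : Fin n) : ContDiff ℝ (⊤ : ℕ∞) fun y => hessij n Φ y i j := (hΦ.pder j).pder i
    rw [this, pder_const_mul _ _ ((ContDiff.sum fun j _ => (hs j).mul (hΦ.pder j)).diffAt x),
      pder_sum _ _ fun j _ => ((hs j).mul (hΦ.pder j)).diffAt x]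
    congr 1
    refine Finset.sum_congr rfl fun j _ => ?_
    rw [pder_mul _ ((hs j).diffAt x) ((hΦ.pder j).diffAt x), ← h3]
    simp only [hessij]
    ring
  have h2 (j : Fin n) : pder n j (lapl n Φ) x
      = ∑ i, pder n j (fun y => pder n i (fun z => pder n i Φ z) y) x :=
    pder_sum _ _ fun i _ => ((hΦ.pder i).pder i).diffAt x
  simp only [h2, Finset.sum_mul]
  rw [Finset.sum_comm (f := fun j i => pder n j (fun y => pder n i (fun z => pder n i Φ z) y) x
    * pder n j Φ x), hessFrob, ← Finset.sum_add_distrib, lapl, Finset.mul_sum]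
  refine Finset.sum_congr rfl fun i _ => ?_
  rw [h1, Finset.sum_add_distrib]

lemma pder_inner (hΦ : ContDiff ℝ (⊤ : ℕ∞) Φ) (hm : ContDiff ℝ (⊤ : ℕ∞) m)
    (x : EuclideanSpace ℝ (Fin n)) (i : Fin n) :
    pder n i (fun y => ∑ k, pder n k m y * pder n k Φ y) x
      = ∑ k, hessij n m x i k * pder n k Φ x + ∑ k, hessij n Φ x i k * pder n k m x := by
  rw [pder_sum _ _ fun j _ => (((hm.pder j).mul (hΦ.pder j)).diffAt x), ← Finset.sum_add_distrib]
  refine Finset.sum_congr rfl fun j _ => ?_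
  rw [pder_mul _ ((hm.pder j).diffAt x) ((hΦ.pder j).diffAt x)]
  simp only [hessij]
  ring

lemma pder_driftOp (hΦ : ContDiff ℝ (⊤ : ℕ∞) Φ) (hm : ContDiff ℝ (⊤ : ℕ∞) m)
    (x : EuclideanSpace ℝ (Fin n)) (c : ℝ) (i : Fin n) :
    pder n i (driftOp c m Φ) x = -pder n i m x * lapl n Φ x - m x * pder n i (lapl n Φ) x
      + c * pder n i (fun y => ∑ k, pder n k m y * pder n k Φ y) x := by
  have hl := hΦ.lapl
  have hS : ContDiff ℝ (⊤ : ℕ∞) (fun y => ∑ k, pder n k m y * pder n k Φ y) := by fun_prop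
  have : driftOp c m Φ
      = fun y => (-1) * (m y * lapl n Φ y) + c * ∑ k, pder n k m y * pder n k Φ y := by
    funext y
    simp only [driftOp]
    ring
  rw [this, pder_add _ ((contDiff_const.mul (hm.mul hl)).diffAt x)
    ((contDiff_const.mul hS).diffAt x), pder_const_mul _ _ ((hm.mul hl).diffAt x),
    pder_const_mul _ _ (hS.diffAt x), pder_mul _ (hm.diffAt x) (hl.diffAt x)]
  ring

lemma sum_mul_pder_gradSq (hΦ : ContDiff ℝ (⊤ : ℕ∞) Φ) (x : EuclideanSpace ℝ (Fin n))
    (w : Fin n → ℝ) :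
    ∑ i, w i * pder n i (gradSq Φ) x = 2 * ∑ i, ∑ j, hessij n Φ x i j * w i * pder n j Φ x := by
  rw [Finset.mul_sum]
  refine Finset.sum_congr rfl fun i _ => ?_
  rw [pder_gradSq hΦ, Finset.mul_sum, Finset.mul_sum, Finset.mul_sum]
  exact Finset.sum_congr rfl fun j _ => by ring

lemma sum_pder_inner_mul (hΦ : ContDiff ℝ (⊤ : ℕ∞) Φ) (hm : ContDiff ℝ (⊤ : ℕ∞) m)
    (x : EuclideanSpace ℝ (Fin n)) :
    ∑ i, pder n i (fun y => ∑ k, pder n k m y * pder n k Φ y) x * pder n i Φ x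
      = ∑ i, ∑ j, hessij n m x i j * pder n i Φ x * pder n j Φ x
        + ∑ i, ∑ j, hessij n Φ x i j * pder n i m x * pder n j Φ x := by
  have hc : ∑ i, ∑ j, hessij n Φ x i j * pder n i m x * pder n j Φ x
      = ∑ i, ∑ j, hessij n Φ x i j * pder n j m x * pder n i Φ x := by
    rw [Finset.sum_comm]
    refine Finset.sum_congr rfl fun i _ => Finset.sum_congr rfl fun j _ => ?_
    rw [hessij, pder_comm hΦ]
    rfl
  rw [hc, ← Finset.sum_add_distrib]
  refine Finset.sum_congr rfl fun i _ => ?_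
  rw [pder_inner hΦ hm, add_mul, Finset.sum_mul, Finset.sum_mul]
  congr 1
  exact Finset.sum_congr rfl fun j _ => by ring

end Expansions

lemma driftOp_const_mul (c a : ℝ) (m : EuclideanSpace ℝ (Fin n) → ℝ)
    {f : EuclideanSpace ℝ (Fin n) → ℝ} (hf : ContDiff ℝ (⊤ : ℕ∞) f)
    (x : EuclideanSpace ℝ (Fin n)) :
    driftOp c m (fun y => a * f y) x = a * driftOp c m f x := by
  have h (i : Fin n) : (fun y => pder n i (fun z => a * f z) y) = fun y => a * pder n i f y :=
    funext fun y => pder_const_mul _ _ (hf.diffAt y)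
  have h' (i : Fin n) : pder n i (fun z => a * f z) x = a * pder n i f x :=
    congrFun (h i) x
  have h2 (i : Fin n) : pder n i (fun y => a * pder n i f y) x
      = a * pder n i (fun y => pder n i f y) x := pder_const_mul _ _ ((hf.pder i).diffAt x)
  simp only [driftOp, lapl, h, h', h2, ← Finset.mul_sum]
  simp only [mul_left_comm _ a, ← Finset.mul_sum]
  ring

section Variations

variable {K : Set (EuclideanSpace ℝ (Fin n))} {ρ Φ m : EuclideanSpace ℝ (Fin n) → ℝ}

lemma driftOp_eq_zero_of_notMem (hK : IsCompact K) (hz : ∀ x ∉ K, Φ x = 0)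
    (c : ℝ) : ∀ x ∉ K, driftOp c m Φ x = 0 := by
  intro x hx
  have h1 (i : Fin n) := pder_eq_zero_of_notMem hK.isClosed hz i
  have h2 (i : Fin n) := pder_eq_zero_of_notMem hK.isClosed (h1 i) i x hx
  simp [driftOp, lapl, h1 _ x hx, h2]

/-- Integrated by parts, the derivative of the divergence is the pairing of the density
with a second-order operator applied to the potential. -/
lemma integral_first_variation (hK : IsCompact K) (hρ : ContDiff ℝ (⊤ : ℕ∞) ρ)
    (hpos : ∀ x, 0 < ρ x) (hΦ : ContDiff ℝ (⊤ : ℕ∞) Φ) (hm : ContDiff ℝ (⊤ : ℕ∞) m)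
    (hz : ∀ x ∉ K, Φ x = 0) {γ : ℝ} (hγ : γ ≠ 1) :
    ∫ x, 1 / (1 - γ) * (m x * ρ x ^ (1 - γ))
        * (-∑ j, pder n j (fun y => ρ y ^ γ * pder n j Φ y) x)
      = ∫ x, ρ x * driftOp (γ / (1 - γ)) m Φ x := by
  have hγ' : 1 - γ ≠ 0 := sub_ne_zero.2 hγ.symm
  have hp (a : ℝ) : ContDiff ℝ (⊤ : ℕ∞) (fun x => ρ x ^ a) :=
    hρ.rpow_const_of_ne fun x => (hpos x).ne'
  have hz' (i : Fin n) := pder_eq_zero_of_notMem hK.isClosed hz i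
  have hu : ContDiff ℝ (⊤ : ℕ∞) (fun x => 1 / (1 - γ) * (m x * ρ x ^ (1 - γ))) :=
    contDiff_const.mul (hm.mul (hp _))
  have z1 := integral_mul_div_add hK hu (v := fun j y => ρ y ^ γ * pder n j Φ y)
    (fun j => (hp γ).mul (hΦ.pder j)) (fun j x hx => by simp [hz' j x hx])
  have z2 := integral_mul_div_add hK (hρ.mul hm) (v := fun j y => pder n j Φ y)
    (fun j => hΦ.pder j) hz'
  refine integral_eq_of_eq_add ?_ (z2.sub z1) fun x => ?_
  · exact (hρ.mul (contDiff_driftOp hΦ hm _)).continuous.integrable_of_zero_off hK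
      fun x hx => by simp [driftOp_eq_zero_of_notMem hK hz _ x hx]
  have h1 (i : Fin n) : pder n i (fun x => 1 / (1 - γ) * (m x * ρ x ^ (1 - γ))) x
        * (ρ x ^ γ * pder n i Φ x)
      = 1 / (1 - γ) * ρ x * (pder n i m x * pder n i Φ x)
        + m x * (pder n i ρ x * pder n i Φ x) := by
    rw [pder_const_mul _ _ ((hm.mul (hp _)).diffAt x), pder_mul _ (hm.diffAt x) ((hp _).diffAt x),
      pder_rpow _ _ (hρ.diffAt x) (hpos x).ne']
    have a1 : ρ x ^ (1 - γ) * ρ x ^ γ = ρ x := by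
      rw [← Real.rpow_add (hpos x)]; simp
    have a2 : ρ x ^ (1 - γ - 1) * ρ x ^ γ = 1 := by
      rw [← Real.rpow_add (hpos x)]; simp
    field_simp
    linear_combination (pder n i m x) * pder n i Φ x * a1
      + (1 - γ) * m x * pder n i ρ x * pder n i Φ x * a2
  have h2 (i : Fin n) : pder n i (fun x => ρ x * m x) x * pder n i Φ x
      = m x * (pder n i ρ x * pder n i Φ x) + ρ x * (pder n i m x * pder n i Φ x) := by
    rw [pder_mul _ (hρ.diffAt x) (hm.diffAt x)]
    ring
  simp only [h1, h2, Finset.sum_add_distrib, ← Finset.mul_sum, driftOp, lapl]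
  field_simp
  ring

/-- The derivative of the pairing `∫ ρ (-m ΔΦ + γ/(1-γ) ⟨∇m, ∇Φ⟩)` along the co-geodesic flow,
with all third-order derivatives removed by integration by parts. -/
lemma integral_second_variation (hK : IsCompact K) (hρ : ContDiff ℝ (⊤ : ℕ∞) ρ)
    (hpos : ∀ x, 0 < ρ x) (hΦ : ContDiff ℝ (⊤ : ℕ∞) Φ) (hm : ContDiff ℝ (⊤ : ℕ∞) m)
    (hz : ∀ x ∉ K, Φ x = 0) {γ : ℝ} (hγ : γ ≠ 1) :
    ∫ x, ((-∑ j, pder n j (fun y => ρ y ^ γ * pder n j Φ y) x) * driftOp (γ / (1 - γ)) m Φ x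
        + ρ x * driftOp (γ / (1 - γ)) m (fun y => -(γ / 2) * (ρ y ^ (γ - 1) * gradSq Φ y)) x)
      = ∫ x, ρ x ^ γ *
          (-lapl n m x * gradSq Φ x
            - 1 / (γ - 1) * ∑ i, ∑ j, hessij n m x i j * pder n i Φ x * pder n j Φ x
            + m x * hessFrob n Φ x
            + γ * ((∑ i, pder n i ρ x * pder n i Φ x) / ρ x * ∑ i, pder n i m x * pder n i Φ x
              - 1 / 2 * ((∑ i, pder n i ρ x * pder n i m x) / ρ x
                + (γ - 1) * m x * (∑ i, pder n i ρ x ^ 2) / ρ x ^ 2) * gradSq Φ x)) := by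
  have hγ' : 1 - γ ≠ 0 := sub_ne_zero.2 hγ.symm
  have hγ'' : γ - 1 ≠ 0 := sub_ne_zero.2 hγ
  have hp (a : ℝ) : ContDiff ℝ (⊤ : ℕ∞) (fun x => ρ x ^ a) :=
    hρ.rpow_const_of_ne fun x => (hpos x).ne'
  have hz1 (i : Fin n) := pder_eq_zero_of_notMem hK.isClosed hz i
  have hψ := contDiff_gradSq hΦ
  have hψz : ∀ x ∉ K, gradSq Φ x = 0 := fun x hx => by simp [gradSq, hz1 _ x hx]
  have hψz1 (i : Fin n) := pder_eq_zero_of_notMem hK.isClosed hψz i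
  have hhψ : ContDiff ℝ (⊤ : ℕ∞) (fun y => ρ y ^ (γ - 1) * gradSq Φ y) := (hp _).mul hψ
  have hhz : ∀ x ∉ K, ρ x ^ (γ - 1) * gradSq Φ x = 0 := fun x hx => by simp [hψz x hx]
  have hS : ContDiff ℝ (⊤ : ℕ∞) (fun y => ∑ k, pder n k m y * pder n k Φ y) := by fun_prop
  have hq := contDiff_driftOp hΦ hm (γ / (1 - γ))
  have z1 := integral_mul_div_add hK hq (v := fun j y => ρ y ^ γ * pder n j Φ y)
    (fun j => (hp γ).mul (hΦ.pder j)) (fun j x hx => by simp [hz1 j x hx])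
  have z2 := integral_mul_div_add hK (hρ.mul hm)
    (v := fun j y => pder n j (fun z => ρ z ^ (γ - 1) * gradSq Φ z) y)
    (fun j => hhψ.pder j) (fun j => pder_eq_zero_of_notMem hK.isClosed hhz j)
  have z3 := integral_mul_div_add hK (hm.mul (hp γ))
    (v := fun j y => pder n j (gradSq Φ) y) (fun j => hψ.pder j) hψz1
  have z4 := integral_mul_div_add hK (hp γ)
    (v := fun j y => gradSq Φ y * pder n j m y)
    (fun j => hψ.mul (hm.pder j)) (fun j x hx => by simp [hψz x hx])
  have z5 := integral_mul_div_add hK (hp γ)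
    (v := fun j y => (∑ k, pder n k m y * pder n k Φ y) * pder n j Φ y)
    (fun j => hS.mul (hΦ.pder j)) (fun j x hx => by simp [hz1 j x hx])
  refine integral_eq_of_eq_add ?_
    (((((z2.const_mul (γ / 2)).sub z1).sub (z3.const_mul (1 / 2))).add z4).sub z5) fun x => ?_
  · refine Continuous.integrable_of_zero_off ?_ hK fun x hx => ?_
    · have c1 := (hp γ).continuous
      have c2 : Continuous (lapl n m) := hm.lapl.continuous
      have c3 (f) (hf : ContDiff ℝ (⊤ : ℕ∞) f) (i j : Fin n) :
        Continuous (fun x => hessij n f x i j) := ((hf.pder j).pder i).continuous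
      have c4 := c3 m hm
      have c5 : Continuous (hessFrob n Φ) := by
        have := c3 Φ hΦ
        unfold hessFrob
        fun_prop
      have c6 := hψ.continuous
      have c7 (f) (hf : ContDiff ℝ (⊤ : ℕ∞) f) (i : Fin n) :
        Continuous (fun x => pder n i f x) := (hf.pder i).continuous
      have c8 := c7 m hm
      have c9 := c7 Φ hΦ
      have c10 := c7 ρ hρ
      have c11 := hρ.continuous
      have c12 := hm.continuous
      simp only [div_eq_mul_inv, ← inv_pow]
      refine c1.mul ?_
      fun_prop (disch := exact fun x => (hpos x).ne')
    · have hz2 (i j : Fin n) := pder_eq_zero_of_notMem hK.isClosed (hz1 j) i x hx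
      simp [hz1 _ x hx, hψz x hx, hessFrob, hessij, hz2]
  have hρx := (hpos x).ne'
  have hk : ρ x ^ (γ - 1) = ρ x ^ (γ - 1 - 1) * ρ x := by
    rw [← Real.rpow_add_one hρx]; simp
  have hP : ρ x ^ γ = ρ x ^ (γ - 1 - 1) * ρ x * ρ x := by
    rw [← hk, ← Real.rpow_add_one hρx]; simp
  have p1 (i : Fin n) : pder n i (fun z => ρ z ^ (γ - 1) * gradSq Φ z) x
      = (γ - 1) * ρ x ^ (γ - 1 - 1) * gradSq Φ x * pder n i ρ x
        + ρ x ^ (γ - 1) * pder n i (gradSq Φ) x := by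
    rw [pder_mul _ ((hp _).diffAt x) (hψ.diffAt x), pder_rpow _ _ (hρ.diffAt x) hρx]
    ring
  have p2 (i : Fin n) : pder n i (fun z => ρ z ^ γ) x = γ * ρ x ^ (γ - 1) * pder n i ρ x :=
    pder_rpow _ _ (hρ.diffAt x) hρx
  have sρ := sum_mul_pder_gradSq hΦ x fun i => pder n i ρ x
  have sm := sum_mul_pder_gradSq hΦ x fun i => pder n i m x
  have sin := sum_pder_inner_mul hΦ hm x
  have sbo := lapl_gradSq hΦ x
  set B := ∑ i, ∑ j, hessij n Φ x i j * pder n i m x * pder n j Φ x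
  set C := ∑ i, ∑ j, hessij n Φ x i j * pder n i ρ x * pder n j Φ x
  set Hm := ∑ i, ∑ j, hessij n m x i j * pder n i Φ x * pder n j Φ x
  set T := ∑ j, pder n j (lapl n Φ) x * pder n j Φ x with hT
  set S := ∑ i, pder n i m x * pder n i Φ x with hS'
  set R := ∑ i, pder n i ρ x * pder n i Φ x with hR
  set N := ∑ i, pder n i ρ x * pder n i m x with hN
  set Q := ∑ i, pder n i ρ x ^ 2 with hQ
  set k := ρ x ^ (γ - 1 - 1)
  -- the first-order parts of the five divergences
  have q1 : ∑ i, pder n i (driftOp (γ / (1 - γ)) m Φ) x * (ρ x ^ γ * pder n i Φ x)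
      = ρ x ^ γ * (-lapl n Φ x * S - m x * T + γ / (1 - γ) * (Hm + B)) := by
    rw [← sin, hS', hT, Finset.mul_sum, Finset.mul_sum, Finset.mul_sum, ← Finset.sum_sub_distrib,
      ← Finset.sum_add_distrib, Finset.mul_sum]
    refine Finset.sum_congr rfl fun i _ => ?_
    rw [pder_driftOp hΦ hm]
    ring
  have q2' (w : Fin n → ℝ) : ∑ i, w i * pder n i (fun z => ρ z ^ (γ - 1) * gradSq Φ z) x
      = (γ - 1) * k * gradSq Φ x * ∑ i, pder n i ρ x * w i
        + ρ x ^ (γ - 1) * ∑ i, w i * pder n i (gradSq Φ) x := by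
    rw [Finset.mul_sum, Finset.mul_sum, ← Finset.sum_add_distrib]
    refine Finset.sum_congr rfl fun i _ => ?_
    rw [p1]
    ring
  have q2m := q2' fun i => pder n i m x
  have q2ρ := q2' fun i => pder n i ρ x
  simp only [← pow_two] at q2ρ
  rw [sm] at q2m
  rw [sρ] at q2ρ
  have q2 : ∑ i, pder n i (fun y => ρ y * m y) x
        * pder n i (fun z => ρ z ^ (γ - 1) * gradSq Φ z) x
      = m x * ((γ - 1) * k * gradSq Φ x * Q + ρ x ^ (γ - 1) * (2 * C))
        + ρ x * ((γ - 1) * k * gradSq Φ x * N + ρ x ^ (γ - 1) * (2 * B)) := by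
    rw [← q2m, ← q2ρ, Finset.mul_sum, Finset.mul_sum, ← Finset.sum_add_distrib]
    refine Finset.sum_congr rfl fun i _ => ?_
    rw [pder_mul _ (hρ.diffAt x) (hm.diffAt x)]
    ring
  have q3 : ∑ i, pder n i (fun y => m y * ρ y ^ γ) x * pder n i (gradSq Φ) x
      = ρ x ^ γ * (2 * B) + m x * (γ * ρ x ^ (γ - 1)) * (2 * C) := by
    rw [← sm, ← sρ, Finset.mul_sum, Finset.mul_sum, ← Finset.sum_add_distrib]
    refine Finset.sum_congr rfl fun i _ => ?_
    rw [pder_mul _ (hm.diffAt x) ((hp γ).diffAt x), p2]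
    ring
  have q4 : ∑ i, pder n i (fun y => ρ y ^ γ) x * (gradSq Φ x * pder n i m x)
      = γ * ρ x ^ (γ - 1) * gradSq Φ x * N := by
    rw [hN, Finset.mul_sum]
    exact Finset.sum_congr rfl fun i _ => by rw [p2]; ring
  have q4' : ∑ i, pder n i (fun y => gradSq Φ y * pder n i m y) x
      = 2 * B + gradSq Φ x * lapl n m x := by
    rw [← sm, lapl, Finset.mul_sum, ← Finset.sum_add_distrib]
    refine Finset.sum_congr rfl fun i _ => ?_
    rw [pder_mul _ (hψ.diffAt x) ((hm.pder i).diffAt x)]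
    ring
  have q5 : ∑ i, pder n i (fun y => ρ y ^ γ) x * (S * pder n i Φ x)
      = γ * ρ x ^ (γ - 1) * S * R := by
    rw [hR, Finset.mul_sum]
    exact Finset.sum_congr rfl fun i _ => by rw [p2]; ring
  have q5' : ∑ i, pder n i (fun y => (∑ k, pder n k m y * pder n k Φ y) * pder n i Φ y) x
      = Hm + B + S * lapl n Φ x := by
    rw [← sin, lapl, Finset.mul_sum, ← Finset.sum_add_distrib]
    refine Finset.sum_congr rfl fun i _ => ?_
    rw [pder_mul _ (hS.diffAt x) ((hΦ.pder i).diffAt x)]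
  have q6 : ∑ i, pder n i (fun y => pder n i (gradSq Φ) y) x = 2 * (hessFrob n Φ x + T) := sbo
  rw [driftOp_const_mul _ _ _ hhψ]
  rw [q1, q2, q3, q4, q4', q5, q5', q6, driftOp, driftOp, q2m]
  simp only [lapl]
  rw [hk, hP]
  field_simp
  ring

end Variations

namespace JointlySmooth

variable {δ : ℝ} {Φ : ℝ → EuclideanSpace ℝ (Fin n) → ℝ} {m : EuclideanSpace ℝ (Fin n) → ℝ}

lemma of_space (hm : ContDiff ℝ (⊤ : ℕ∞) m) : JointlySmooth δ fun _ => m :=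
  (hm.comp contDiff_snd).contDiffOn

lemma driftOp (hΦ : JointlySmooth δ Φ) (hm : ContDiff ℝ (⊤ : ℕ∞) m) (c : ℝ) :
    JointlySmooth δ fun t x => _root_.driftOp c m (Φ t) x :=
  ((of_space hm).neg.mul (ContDiffOn.sum fun i _ => (hΦ.pder i).pder i)).add
    (contDiffOn_const.mul
      (ContDiffOn.sum fun i _ => (of_space (hm.pder i)).mul (hΦ.pder i)))

lemma hasDerivAt_driftOp (hΦ : JointlySmooth δ Φ) (c : ℝ) {t : ℝ} (ht : t ∈ Ioo (-δ) δ)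
    (x : EuclideanSpace ℝ (Fin n)) :
    HasDerivAt (fun s => _root_.driftOp c m (Φ s) x)
      (_root_.driftOp c m (fun y => _root_.deriv (fun s => Φ s y) t) x) t := by
  have h1 (i : Fin n) (y : EuclideanSpace ℝ (Fin n)) := (hΦ.pder i).hasDerivAt ht y
  have h2 (i : Fin n) := ((hΦ.pder i).pder i).hasDerivAt ht x
  simp only [fun i y => hΦ.deriv_pder ht y i] at h1
  simp only [fun i => (hΦ.pder i).deriv_pder ht x i, fun i y => hΦ.deriv_pder ht y i] at h2
  exact ((HasDerivAt.fun_sum fun i _ => h2 i).const_mul (-m x)).add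
    ((HasDerivAt.fun_sum fun i _ => (h1 i x).const_mul (_root_.pder n i m x)).const_mul c)

end JointlySmooth

lemma divg_smul_gradient (w Φ : EuclideanSpace ℝ (Fin n) → ℝ) (x : EuclideanSpace ℝ (Fin n)) :
    divg n (fun y => w y • gradient Φ y) x = ∑ j, pder n j (fun y => w y * pder n j Φ y) x := by
  simp [divg, gradient_apply]

lemma inner_smul_gradient (a : ℝ) (f g : EuclideanSpace ℝ (Fin n) → ℝ)
    (x : EuclideanSpace ℝ (Fin n)) :
    ⟪a • gradient f x, gradient g x⟫_ℝ = a * ∑ i, pder n i f x * pder n i g x := by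
  rw [real_inner_smul_left, PiLp.inner_apply]
  simp only [gradient_apply, RCLike.inner_apply, conj_trivial, mul_comm]

/-- The time derivative of the integrand of the `γ`-divergence. -/
lemma hasDerivAt_divergence_density {γ a M C : ℝ} (hγ1 : γ ≠ 1) (hγ2 : γ ≠ 2) (hM : 0 < M)
    {r : ℝ → ℝ} {t : ℝ} (hr : HasDerivAt r a t) (hpos : 0 < r t) :
    HasDerivAt (fun s => (((r s / M) ^ (2 - γ) - 1) / ((1 - γ) * (2 - γ)) - C) * M)
      (1 / (1 - γ) * (M ^ (γ - 1) * r t ^ (1 - γ)) * a) t := by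
  have h1 : 1 - γ ≠ 0 := sub_ne_zero.2 hγ1.symm
  have h2 : 2 - γ ≠ 0 := sub_ne_zero.2 hγ2.symm
  have hd := (((((hr.div_const M).rpow_const (p := 2 - γ)
    (Or.inl (div_pos hpos hM).ne')).sub_const 1).div_const ((1 - γ) * (2 - γ))).sub_const
    C).mul_const M
  refine hd.congr_deriv ?_
  have e : (r t / M) ^ (2 - γ - 1) = M ^ (γ - 1) * r t ^ (1 - γ) := by
    rw [show 2 - γ - 1 = 1 - γ by ring, Real.div_rpow hpos.le hM.le,
      show γ - 1 = -(1 - γ) by ring, Real.rpow_neg hM.le]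
    field_simp
  rw [e]
  field_simp

/-- Hessian of the γ-divergence along the γ-Wasserstein
co-geodesic flow (Lemma 7, flat Euclidean space).  With
`f(s) = (s^{2−γ} − 1)/((1−γ)(2−γ))` and
`G(t) = ∫ (f(ρₜ/μ) − f(ρ₀/μ)) μ dx`, the function `G` is twice differentiable
at `t = 0` and `G''(0)` is given by the explicit Hessian formula. -/
theorem stmt14 (n : ℕ) (hn : 1 ≤ n) (γ : ℝ) (hγ1 : γ ≠ 1) (hγ2 : γ ≠ 2)
    (μ : EuclideanSpace ℝ (Fin n) → ℝ) (hμ : ContDiff ℝ (⊤ : ℕ∞) μ)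
    (hμpos : ∀ x, 0 < μ x)
    (δ : ℝ) (hδ : 0 < δ)
    (ρ Φ : ℝ → EuclideanSpace ℝ (Fin n) → ℝ)
    (hρ : ContDiffOn ℝ (⊤ : ℕ∞) (fun p : ℝ × EuclideanSpace ℝ (Fin n) => ρ p.1 p.2)
      (Ioo (-δ) δ ×ˢ univ))
    (hΦ : ContDiffOn ℝ (⊤ : ℕ∞) (fun p : ℝ × EuclideanSpace ℝ (Fin n) => Φ p.1 p.2)
      (Ioo (-δ) δ ×ˢ univ))
    (hρpos : ∀ t ∈ Ioo (-δ) δ, ∀ x, 0 < ρ t x)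
    (K : Set (EuclideanSpace ℝ (Fin n))) (hK : IsCompact K)
    (hsupp : ∀ t ∈ Ioo (-δ) δ, ∀ x ∉ K, Φ t x = 0 ∧ ρ t x = ρ 0 x)
    (hcont : ∀ t ∈ Ioo (-δ) δ, ∀ x, deriv (fun s => ρ s x) t
      + divg n (fun y => (ρ t y)^γ • gradient (Φ t) y) x = 0)
    (hHJ : ∀ t ∈ Ioo (-δ) δ, ∀ x, deriv (fun s => Φ s x) t
      + (γ/2) * (ρ t x)^(γ-1) * ‖gradient (Φ t) x‖^2 = 0)
    (G : ℝ → ℝ)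
    (hG : ∀ t, G t = ∫ x,
      (((ρ t x / μ x)^(2-γ) - 1)/((1-γ)*(2-γ))
        - ((ρ 0 x / μ x)^(2-γ) - 1)/((1-γ)*(2-γ))) * μ x) :
    DifferentiableAt ℝ G 0 ∧ DifferentiableAt ℝ (deriv G) 0 ∧
    deriv (deriv G) 0
      = ∫ x, (ρ 0 x)^γ *
          (-(lapl n (fun y => (μ y)^(γ-1)) x) * ‖gradient (Φ 0) x‖^2
            - (1/(γ-1)) * hessQF n (fun y => (μ y)^(γ-1)) x (gradient (Φ 0) x)
            + (μ x)^(γ-1) * hessFrob n (Φ 0) x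
            + γ*(γ-1) * (μ x)^(γ-1) *
              (⟪(ρ 0 x)⁻¹ • gradient (ρ 0) x, gradient (Φ 0) x⟫_ℝ
                  * ⟪(μ x)⁻¹ • gradient μ x, gradient (Φ 0) x⟫_ℝ
                - (1/2) * ⟪(ρ 0 x)⁻¹ • gradient (ρ 0) x,
                    (μ x)⁻¹ • gradient μ x + (ρ 0 x)⁻¹ • gradient (ρ 0) x⟫_ℝ
                  * ‖gradient (Φ 0) x‖^2)) := by
  have h0 : (0 : ℝ) ∈ Ioo (-δ) δ := ⟨neg_lt_zero.2 hδ, hδ⟩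
  replace hρ : JointlySmooth δ ρ := hρ
  replace hΦ : JointlySmooth δ Φ := hΦ
  have hm : ContDiff ℝ (⊤ : ℕ∞) (fun y => μ y ^ (γ - 1)) :=
    hμ.rpow_const_of_ne fun x => (hμpos x).ne'
  have hρt : ∀ t ∈ Ioo (-δ) δ, ∀ x, deriv (fun s => ρ s x) t
      = -∑ j, pder n j (fun y => ρ t y ^ γ * pder n j (Φ t) y) x := fun t ht x => by
    rw [← divg_smul_gradient]
    linarith [hcont t ht x]
  have hΦt : (fun y => deriv (fun s => Φ s y) 0)
      = fun y => -(γ / 2) * (ρ 0 y ^ (γ - 1) * gradSq (Φ 0) y) := by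
    funext y
    rw [← gradient_norm_sq]
    linarith [hHJ 0 h0 y]
  have hg : JointlySmooth δ fun t x =>
      (((ρ t x / μ x) ^ (2 - γ) - 1) / ((1 - γ) * (2 - γ))
        - ((ρ 0 x / μ x) ^ (2 - γ) - 1) / ((1 - γ) * (2 - γ))) * μ x := by
    have hμ' := JointlySmooth.of_space (δ := δ) hμ
    have hterm {r : ℝ → EuclideanSpace ℝ (Fin n) → ℝ} (hr : JointlySmooth δ r)
        (hrpos : ∀ t ∈ Ioo (-δ) δ, ∀ x, 0 < r t x) : JointlySmooth δ fun t x =>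
          ((r t x / μ x) ^ (2 - γ) - 1) / ((1 - γ) * (2 - γ)) :=
      (((hr.div hμ' fun p _ => (hμpos p.2).ne').rpow_const_of_ne fun p hp =>
        (div_pos (hrpos p.1 hp.1 p.2) (hμpos p.2)).ne').sub contDiffOn_const).div_const _
    exact ((hterm hρ hρpos).sub
      (hterm (JointlySmooth.of_space (hρ.slice h0)) fun _ _ => hρpos 0 h0)).mul hμ'
  have hG1 : ∀ t ∈ Ioo (-δ) δ, HasDerivAt G
      (∫ x, ρ t x * driftOp (γ / (1 - γ)) (fun y => μ y ^ (γ - 1)) (Φ t) x) t := by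
    intro t ht
    have hd := hg.hasDerivAt_integral hK (fun s hs x hx => by simp [(hsupp s hs x hx).2]) ht
    rw [← funext hG] at hd
    rw [← integral_first_variation hK (hρ.slice ht) (hρpos t ht) (hΦ.slice ht) hm
      (fun x hx => (hsupp t ht x hx).1) hγ1]
    convert hd using 3 with x
    rw [(hasDerivAt_divergence_density hγ1 hγ2 (hμpos x) (hρ.hasDerivAt ht x)
      (hρpos t ht x)).deriv, hρt t ht x]
  have hH : JointlySmooth δ fun t x =>
      ρ t x * driftOp (γ / (1 - γ)) (fun y => μ y ^ (γ - 1)) (Φ t) x :=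
    ContDiffOn.mul hρ (hΦ.driftOp hm _)
  have hG' : deriv G =ᶠ[𝓝 0] fun t =>
      ∫ x, ρ t x * driftOp (γ / (1 - γ)) (fun y => μ y ^ (γ - 1)) (Φ t) x := by
    filter_upwards [isOpen_Ioo.mem_nhds h0] with t ht using (hG1 t ht).deriv
  have hG2 := (hH.hasDerivAt_integral hK (fun t ht x hx => by
    simp [driftOp_eq_zero_of_notMem hK (fun x hx => (hsupp t ht x hx).1) _ x hx])
    h0).congr_of_eventuallyEq hG'
  refine ⟨(hG1 0 h0).differentiableAt, hG2.differentiableAt, hG2.deriv.trans ?_⟩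
  have hHt (x) : deriv (fun s => ρ s x *
      driftOp (γ / (1 - γ)) (fun y => μ y ^ (γ - 1)) (Φ s) x) 0 = _ :=
    ((hρ.hasDerivAt h0 x).mul (hΦ.hasDerivAt_driftOp _ h0 x)).deriv
  simp only [hHt, hρt 0 h0, hΦt]
  rw [integral_second_variation hK (hρ.slice h0) (hρpos 0 h0) (hΦ.slice h0) hm
    (fun x hx => (hsupp 0 h0 x hx).1) hγ1]
  congr 1
  funext x
  have hγ' : γ - 1 ≠ 0 := sub_ne_zero.2 hγ1
  have hρx := (hρpos 0 h0 x).ne'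
  have hμx := (hμpos x).ne'
  have hmx (i : Fin n) : pder n i (fun y => μ y ^ (γ - 1)) x
      = (γ - 1) * (μ x ^ (γ - 1) / μ x) * pder n i μ x := by
    rw [pder_rpow _ _ (hμ.diffAt x) hμx, Real.rpow_sub_one hμx]
  have hQF : hessQF n (fun y => μ y ^ (γ - 1)) x (gradient (Φ 0) x) = ∑ i, ∑ j,
      hessij n (fun y => μ y ^ (γ - 1)) x i j * pder n i (Φ 0) x * pder n j (Φ 0) x := by
    simp only [hessQF, gradient_apply]
  have hS : ∑ i, pder n i (fun y => μ y ^ (γ - 1)) x * pder n i (Φ 0) x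
      = (γ - 1) * (μ x ^ (γ - 1) / μ x) * ∑ i, pder n i μ x * pder n i (Φ 0) x := by
    simp only [hmx, Finset.mul_sum, mul_assoc]
  have hN : ∑ i, pder n i (ρ 0) x * pder n i (fun y => μ y ^ (γ - 1)) x
      = (γ - 1) * (μ x ^ (γ - 1) / μ x) * ∑ i, pder n i (ρ 0) x * pder n i μ x := by
    simp only [hmx, Finset.mul_sum, mul_left_comm (pder n _ (ρ 0) x)]
  simp only [inner_add_right, real_inner_smul_right, gradient_norm_sq, inner_smul_gradient, hQF,
    hS, hN, ← pow_two]
  field_simp
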